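/- Let m ≥ 2 be an integer, let V ⊆ ℝ^{m−1} be an open neighborhood of 0, and let g : V → ℝ be continuous with g(0) = 0. Define continuous maps h₁ : (−1,1) → ℝᵐ by h₁(t) = (t, 0, …, 0) and h₂ : V → ℝᵐ by h₂(x) = (x₁, …, x_{m−1}, g(x)) (ℝᵐ carrying the Euclidean metric). Suppose h₁ and h₂ are C⁰ transverse at the pair (0, 0). Then for all t₁, t₂ with t₁ < 0 < t₂, [t₁, t₂] ⊆ (−1,1), and {(t, 0, …, 0) : t ∈ [t₁, t₂]} ⊆ V, there exist t, t' ∈ (t₁, t₂) such that g(t, 0, …, 0) > 0 and g(t', 0, …, 0) < 0. -/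

import Mathlib

/-- The intersection `h₁(C) ∩ h₂(D)` is `δ`-essential: for all continuous maps `h₁'`, `h₂'`
within uniform `C⁰` distance `δ` of `h₁`, `h₂` respectively, the images `h₁'(C)` and `h₂'(D)`
still intersect. -/
def DeltaEssential {A B M : Type*} [TopologicalSpace A] [TopologicalSpace B] [MetricSpace M]
    (h₁ : C(A, M)) (h₂ : C(B, M)) (Cs : Set A) (Ds : Set B) (δ : ℝ) : Prop :=
  ∀ (h₁' : C(A, M)) (h₂' : C(B, M)),
    (∀ x : A, dist (h₁ x) (h₁' x) ≤ δ) → (∀ y : B, dist (h₂ y) (h₂' y) ≤ δ) →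
    (h₁' '' Cs ∩ h₂' '' Ds).Nonempty

/-- `h₁` and `h₂` are `C⁰` transverse at the pair `(a, b)`: for all neighborhoods `Ua` of `a`
and `Ub` of `b` there is `δ > 0` such that the intersection `h₁(Ua) ∩ h₂(Ub)` is
`δ`-essential. -/
def C0TransverseAt {A B M : Type*} [TopologicalSpace A] [TopologicalSpace B] [MetricSpace M]
    (h₁ : C(A, M)) (h₂ : C(B, M)) (a : A) (b : B) : Prop :=
  ∀ Ua ∈ nhds a, ∀ Ub ∈ nhds b, ∃ δ > (0 : ℝ), DeltaEssential h₁ h₂ Ua Ub δ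

/-- The last coordinate index of `Fin m` for `m ≥ 1`. -/
def lastIndex (m : ℕ) (hm : 1 ≤ m) : Fin m := ⟨m - 1, by omega⟩

/-- The point `(t, 0, …, 0)` of `ℝⁿ`. -/
noncomputable def axisPoint (n : ℕ) (t : ℝ) : EuclideanSpace ℝ (Fin n) :=
  WithLp.toLp 2 fun i : Fin n => if (i : ℕ) = 0 then t else 0

/-- Let `m ≥ 2`, `V ⊆ ℝ^{m-1}` an open neighborhood of `0`, and `g : V → ℝ`
continuous with `g(0) = 0`.  Let `h₁(t) = (t, 0, …, 0)` on `(-1,1)` and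
`h₂(x) = (x₁, …, x_{m-1}, g(x))` on `V`.  If `h₁` and `h₂` are `C⁰` transverse at the pair
`(0, 0)`, then for all `t₁ < 0 < t₂` with `[t₁, t₂] ⊆ (-1,1)` and
`{(t, 0, …, 0) : t ∈ [t₁, t₂]} ⊆ V`, there are `t, t' ∈ (t₁, t₂)` with
`g(t, 0, …, 0) > 0` and `g(t', 0, …, 0) < 0`. -/
theorem c0Transverse_graph_sign_change (m : ℕ) (hm : 2 ≤ m)
    (V : Set (EuclideanSpace ℝ (Fin (m - 1)))) (hV : IsOpen V) (hV0 : 0 ∈ V)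
    (g : C(V, ℝ)) (hg0 : g ⟨0, hV0⟩ = 0)
    (h₁ : C(Set.Ioo (-1 : ℝ) 1, EuclideanSpace ℝ (Fin m)))
    (hh₁ : ∀ (t : Set.Ioo (-1 : ℝ) 1) (i : Fin m),
      h₁ t i = if (i : ℕ) = 0 then (t : ℝ) else 0)
    (h₂ : C(V, EuclideanSpace ℝ (Fin m)))
    (hh₂ : ∀ (x : V) (i : Fin m),
      h₂ x i = if h : (i : ℕ) + 1 < m
        then (x : EuclideanSpace ℝ (Fin (m - 1))) ⟨(i : ℕ), by omega⟩ else g x)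
    (htrans : C0TransverseAt h₁ h₂ ⟨0, by constructor <;> norm_num⟩ ⟨0, hV0⟩) :
    ∀ t₁ t₂ : ℝ, t₁ < 0 → 0 < t₂ → Set.Icc t₁ t₂ ⊆ Set.Ioo (-1 : ℝ) 1 →
      (∀ t ∈ Set.Icc t₁ t₂, axisPoint (m - 1) t ∈ V) →
      ∃ t, t₁ < t ∧ t < t₂ ∧
        ∃ ht : axisPoint (m - 1) t ∈ V, 0 < g ⟨axisPoint (m - 1) t, ht⟩ ∧
          ∃ t', t₁ < t' ∧ t' < t₂ ∧
            ∃ ht' : axisPoint (m - 1) t' ∈ V, g ⟨axisPoint (m - 1) t', ht'⟩ < 0 := by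
  
  intro t₁ t₂ ht₁ ht₂ hI hIV
  obtain ⟨δ, hδ, hess⟩ := htrans (Subtype.val ⁻¹' Set.Ioo t₁ t₂)
    (continuous_subtype_val.continuousAt.preimage_mem_nhds (Ioo_mem_nhds ht₁ ht₂))
    Set.univ Filter.univ_mem
  have attains : ∀ c : ℝ, |c| ≤ δ → ∃ t, t₁ < t ∧ t < t₂ ∧
      ∃ ht : axisPoint (m - 1) t ∈ V, g ⟨axisPoint (m - 1) t, ht⟩ = c := by
    intro c hc
    have hm' : 1 ≤ m := by omega
    obtain ⟨_, ⟨s, hs, rfl⟩, ⟨x, -, hx⟩⟩ := hess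
      ⟨fun t => h₁ t + EuclideanSpace.single (lastIndex m hm') c, by fun_prop⟩ h₂
      (fun t => by simpa [dist_eq_norm] using hc) (fun y => by simpa using hδ.le)
    have hcoord : ∀ i : Fin m, h₂ x i = h₁ s i + if i = lastIndex m hm' then c else 0 := by
      intro i
      rw [hx]
      simp
    have hxs : (x : EuclideanSpace ℝ (Fin (m - 1))) = axisPoint (m - 1) s := by
      ext i
      have hi : (i : ℕ) + 1 < m := by omega
      have hne : (⟨i, by omega⟩ : Fin m) ≠ lastIndex m hm' := by
        simp only [lastIndex, ne_eq, Fin.mk.injEq]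
        omega
      have h := hcoord ⟨i, by omega⟩
      rw [hh₂, hh₁, dif_pos hi, if_neg hne, add_zero] at h
      simpa [axisPoint] using h
    have hgx : g x = c := by
      have h := hcoord (lastIndex m hm')
      rw [hh₂, hh₁, dif_neg (by simp only [lastIndex]; omega),
        if_neg (by simp only [lastIndex]; omega), if_pos rfl, zero_add] at h
      exact h
    refine ⟨s, hs.1, hs.2, hxs ▸ x.2, ?_⟩
    rw [← hgx]
    congr 1
    exact Subtype.ext hxs.symm
  obtain ⟨t, h1, h2, ht, hg⟩ := attains δ (abs_of_pos hδ).le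
  obtain ⟨t', h1', h2', ht', hg'⟩ := attains (-δ) (by rw [abs_neg, abs_of_pos hδ])
  exact ⟨t, h1, h2, ht, by linarith, t', h1', h2', ht', by linarith⟩
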